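/- arXiv:2209.10309 — 5 statements merged into one kernel-verified Lean document; each statement's English description precedes it below -/
import Mathlib

section
/- Let 𝔄 = (A,(P_σ),f_1,f_2) be a 2-data structure over Σ, ā = (a_1,…,a_n) ∈ A^n, and let f be the data function of ⟦𝔄⟧_ā. Let p ≤ n, b,c ∈ A and j,k ∈ {1,2}. If (b,j) ∈ B_2(a_p) ∖ B_1(a_p) and (c,k) ∈ B_2(a_p) ∖ B_1(a_p), then f_j(b) = f_k(c) if and only if either f(b) = f(c), or there exist p' ≤ n and ℓ ∈ {1,2} such that f_ℓ(a_{p'}) = f_j(b) and f_ℓ(a_{p'}) = f_k(c). -/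
/-- One step in the data graph of a `D`-data structure with data functions `f`:
`(a,i)` and `(b,j)` are related iff `a = b` or `f i a = f j b`. -/
def dataEdge {A : Type} {D : ℕ} (f : Fin D → A → ℕ) (v w : A × Fin D) : Prop :=
  v.1 = w.1 ∨ f v.2 v.1 = f w.2 w.1

/-- `distLE f r v w` holds iff the distance between `v` and `w` in the data graph
is at most `r` (the edge relation is reflexive, so walks may stutter). -/
def distLE {A : Type} {D : ℕ} (f : Fin D → A → ℕ) : ℕ → A × Fin D → A × Fin D → Prop
  | 0 => fun v w => v = w
  | r + 1 => fun v w => ∃ u, distLE f r v u ∧ dataEdge f u w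

/-- `(b,j) ∈ B_r(a)` : membership in the radius-`r` ball around `a`. -/
def inBall {A : Type} {D : ℕ} (f : Fin D → A → ℕ) (r : ℕ) (a : A) (v : A × Fin D) : Prop :=
  ∃ i : Fin D, distLE f r (a, i) v

/-- `Values(𝔄)` : the set of data values occurring in the structure. -/
def dataValues {A : Type} {D : ℕ} (f : Fin D → A → ℕ) : Set ℕ :=
  {v | ∃ (b : A) (i : Fin D), f i b = v}

/-- `IsView f r a fnew f'` : `f'` is the family of data functions of the `r`-view
`𝔄|_a^r`, built from the injection `fnew` into fresh values. -/
def IsView {A : Type} {D : ℕ} (f : Fin D → A → ℕ) (r : ℕ) (a : A)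
    (fnew : A × Fin D → ℕ) (f' : Fin D → A → ℕ) : Prop :=
  ∀ (b : A) (i : Fin D),
    (inBall f r a (b, i) → f' i b = f i b) ∧
    (¬ inBall f r a (b, i) → f' i b = fnew (b, i))

/-- `Val(ā)` : the set of data values carried by the designated tuple `ā`. -/
def tupleValues {A : Type} {D : ℕ} {n : ℕ} (f : Fin D → A → ℕ) (as : Fin n → A) : Set ℕ :=
  {v | ∃ (p : Fin n) (i : Fin D), f i (as p) = v}

/-- `IsAbstraction f as g fabs` : `fabs` is the data function of the 1-data
structure `⟦𝔄⟧_ā` (here `f 0 = f_1`, `f 1 = f_2` and `g` is the fixed injection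
into fresh values). -/
def IsAbstraction {A : Type} {n : ℕ} (f : Fin 2 → A → ℕ) (as : Fin n → A)
    (g : A → ℕ) (fabs : A → ℕ) : Prop :=
  ∀ b : A,
    ((f 0 b ∈ tupleValues f as ∧ f 1 b ∉ tupleValues f as) → fabs b = f 1 b) ∧
    ((f 0 b ∉ tupleValues f as ∧ f 1 b ∈ tupleValues f as) → fabs b = f 0 b) ∧
    ((¬ (f 0 b ∈ tupleValues f as ∧ f 1 b ∉ tupleValues f as) ∧
      ¬ (f 0 b ∉ tupleValues f as ∧ f 1 b ∈ tupleValues f as)) → fabs b = g b)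

/-- Vertices in `B_1(a)` are those whose element is `a` or whose value is one of the values of `a`. -/
theorem inBall_one_iff {A : Type} {D : ℕ} {f : Fin D → A → ℕ} {a b : A} {j : Fin D} :
    inBall f 1 a (b, j) ↔ a = b ∨ ∃ i, f i a = f j b := by
  constructor
  · rintro ⟨i, u, rfl, h | h⟩
    · exact Or.inl h
    · exact Or.inr ⟨i, h⟩
  · rintro (h | ⟨i, h⟩)
    · exact ⟨j, _, rfl, Or.inl h⟩
    · exact ⟨i, _, rfl, Or.inr h⟩

/-- An element entering the ball around `a` at distance two carries a value of `a` at some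
coordinate. -/
theorem exists_value_eq_of_inBall_two {A : Type} {D : ℕ} {f : Fin D → A → ℕ} {a b : A}
    {j : Fin D} (h2 : inBall f 2 a (b, j)) (h1 : ¬ inBall f 1 a (b, j)) :
    ∃ l i, f i a = f l b := by
  rw [inBall_one_iff] at h1
  push Not at h1
  obtain ⟨i, ⟨u, l⟩, hu, huv⟩ := h2
  have hu1 : inBall f 1 a (u, l) := ⟨i, hu⟩
  rw [inBall_one_iff] at hu1
  simp only [dataEdge] at huv
  rcases hu1 with rfl | ⟨i', h⟩
  · rcases huv with h | h
    · exact absurd h h1.1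
    · exact absurd h (h1.2 l)
  · rcases huv with rfl | h'
    · exact ⟨l, i', h⟩
    · exact absurd (h.trans h') (h1.2 i')

/-- If `(b, j)` is at distance exactly two from `a p` then the abstract value of `b` is its `j`-th
value, or the fresh value `g b` when the `j`-th value is carried by the tuple. -/
theorem IsAbstraction.eq_of_inBall_two {A : Type} {n : ℕ} {f : Fin 2 → A → ℕ} {as : Fin n → A}
    {g fabs : A → ℕ} (habs : IsAbstraction f as g fabs) {p : Fin n} {b : A} {j : Fin 2}
    (h2 : inBall f 2 (as p) (b, j)) (h1 : ¬ inBall f 1 (as p) (b, j)) :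
    (f j b ∈ tupleValues f as → fabs b = g b) ∧ (f j b ∉ tupleValues f as → fabs b = f j b) := by
  obtain ⟨l, i, h⟩ := exists_value_eq_of_inBall_two h2 h1
  have hl : f l b ∈ tupleValues f as := ⟨p, i, h⟩
  have hlj : l ≠ j := by
    rintro rfl
    exact h1 (inBall_one_iff.2 (Or.inr ⟨i, h⟩))
  obtain ⟨hb0, hb1, hb⟩ := habs b
  fin_cases j <;> fin_cases l <;> simp_all

/-- for `(b,j)` and `(c,k)` in `B_2(a_p) ∖ B_1(a_p)`,
`f_j(b) = f_k(c)` iff either the abstract data values agree, or both values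
coincide with some value `f_ℓ(a_{p'})` of the designated tuple. -/
theorem ball_two_values_agree_abstraction {A : Type} [Finite A] [Nonempty A]
    {Sg : Type} (P : Sg → Set A) (f : Fin 2 → A → ℕ) {n : ℕ} (as : Fin n → A)
    (g : A → ℕ) (hginj : Function.Injective g)
    (hgfresh : ∀ b : A, g b ∉ dataValues f)
    (fabs : A → ℕ) (habs : IsAbstraction f as g fabs)
    (p : Fin n) (b c : A) (j k : Fin 2)
    (hb2 : inBall f 2 (as p) (b, j)) (hb1 : ¬ inBall f 1 (as p) (b, j))
    (hc2 : inBall f 2 (as p) (c, k)) (hc1 : ¬ inBall f 1 (as p) (c, k)) :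
    f j b = f k c ↔
      (fabs b = fabs c ∨
        ∃ (p' : Fin n) (ℓ : Fin 2), f ℓ (as p') = f j b ∧ f ℓ (as p') = f k c) := by
  obtain ⟨hbin, hbout⟩ := habs.eq_of_inBall_two hb2 hb1
  obtain ⟨hcin, hcout⟩ := habs.eq_of_inBall_two hc2 hc1
  constructor
  · intro h
    by_cases hv : f j b ∈ tupleValues f as
    · obtain ⟨p', l, hl⟩ := hv
      exact Or.inr ⟨p', l, hl, hl.trans h⟩
    · exact Or.inl ((hbout hv).trans (h.trans (hcout (h ▸ hv)).symm))
  · rintro (h | ⟨p', l, hl, hl'⟩)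
    · by_cases hv : f j b ∈ tupleValues f as <;> by_cases hw : f k c ∈ tupleValues f as
      · rw [hbin hv, hcin hw] at h
        obtain rfl := hginj h
        obtain ⟨l, i, hl⟩ := exists_value_eq_of_inBall_two hb2 hb1
        have hlj : l ≠ j := by
          rintro rfl
          exact hb1 (inBall_one_iff.2 (Or.inr ⟨i, hl⟩))
        have hlk : l ≠ k := by
          rintro rfl
          exact hc1 (inBall_one_iff.2 (Or.inr ⟨i, hl⟩))
        have hjk : j = k := by omega
        rw [hjk]
      · rw [hbin hv, hcout hw] at h
        exact absurd ⟨c, k, h.symm⟩ (hgfresh b)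
      · rw [hbout hv, hcin hw] at h
        exact absurd ⟨b, j, h⟩ (hgfresh c)
      · rwa [hbout hv, hcout hw] at h
    · exact hl.symm.trans hl'
end

section
/- For every 2-data structure 𝔄 = (A,(P_σ),f_1,f_2) over Σ and every tuple ā = (a_1,…,a_n) ∈ A^n, the structure ⟦𝔄⟧_ā with designated elements a_1,…,a_n satisfies: (Transitivity) for all b,c ∈ A, p,q ≤ n and i,j,k,ℓ ∈ {1,2}, if b ∈ P_{p[i,j]}, c ∈ P_{p[i,ℓ]} and b ∈ P_{q[k,j]}, then c ∈ P_{q[k,ℓ]}; (Reflexivity) for all p ≤ n and i ∈ {1,2}, a_p ∈ P_{p[i,i]}; (Uniqueness) for all b ∈ A, if either b ∈ ⋂_{j=1,2} ⋃_{p≤n, i∈{1,2}} P_{p[i,j]} or b ∉ ⋃_{j∈{1,2}, p≤n, i∈{1,2}} P_{p[i,j]}, then every c ∈ A with f(c) = f(b) satisfies c = b. -/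
/-- An element whose two data values both occur in the tuple, or both do not, keeps its fresh
value in the abstraction. -/
theorem IsAbstraction.eq_fresh {A : Type} {n : ℕ} {f : Fin 2 → A → ℕ} {as : Fin n → A}
    {g fabs : A → ℕ} (habs : IsAbstraction f as g fabs) {b : A}
    (hb : f 0 b ∈ tupleValues f as ↔ f 1 b ∈ tupleValues f as) : fabs b = g b :=
  (habs b).2.2 ⟨fun h => h.2 (hb.1 h.1), fun h => h.1 (hb.2 h.2)⟩

/-- Every value of the abstraction is fresh or a data value of the original structure. -/
theorem IsAbstraction.eq_fresh_or_mem {A : Type} {n : ℕ} {f : Fin 2 → A → ℕ} {as : Fin n → A}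
    {g fabs : A → ℕ} (habs : IsAbstraction f as g fabs) (c : A) :
    fabs c = g c ∨ fabs c ∈ dataValues f := by
  by_cases h0 : f 0 c ∈ tupleValues f as <;> by_cases h1 : f 1 c ∈ tupleValues f as
  · exact .inl (habs.eq_fresh (iff_of_true h0 h1))
  · exact .inr ⟨c, 1, ((habs c).1 ⟨h0, h1⟩).symm⟩
  · exact .inr ⟨c, 0, ((habs c).2.1 ⟨h0, h1⟩).symm⟩
  · exact .inl (habs.eq_fresh (iff_of_false h0 h1))

/-- the abstraction `⟦𝔄⟧_ā` (with predicates
`P_{p[i,j]} = {b | f_i(a_p) = f_j(b)}` and data function `fabs`) satisfies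
transitivity, reflexivity and uniqueness. -/
theorem abstraction_well_formed {A : Type} [Finite A] [Nonempty A]
    {Sg : Type} (P : Sg → Set A) (f : Fin 2 → A → ℕ) {n : ℕ} (as : Fin n → A)
    (g : A → ℕ) (hginj : Function.Injective g)
    (hgfresh : ∀ b : A, g b ∉ dataValues f)
    (fabs : A → ℕ) (habs : IsAbstraction f as g fabs) :
    (∀ (b c : A) (p q : Fin n) (i j k ℓ : Fin 2),
      f i (as p) = f j b → f i (as p) = f ℓ c → f k (as q) = f j b →
        f k (as q) = f ℓ c) ∧
    (∀ (p : Fin n) (i : Fin 2), f i (as p) = f i (as p)) ∧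
    (∀ b : A,
      ((∀ j : Fin 2, ∃ (p : Fin n) (i : Fin 2), f i (as p) = f j b) ∨
       (∀ (p : Fin n) (i j : Fin 2), ¬ f i (as p) = f j b)) →
      ∀ c : A, fabs c = fabs b → c = b) := by
  refine ⟨fun b c p q i j k ℓ hb hc hq => hq.trans (hb.symm.trans hc), fun _ _ => rfl, ?_⟩
  intro b hb c hcb
  have hfresh : fabs b = g b := by
    apply habs.eq_fresh
    rcases hb with hb | hb
    · exact iff_of_true (hb 0) (hb 1)
    · exact iff_of_false (fun ⟨p, i, h⟩ => hb p i 0 h) (fun ⟨p, i, h⟩ => hb p i 1 h)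
  rw [hfresh] at hcb
  rcases habs.eq_fresh_or_mem c with hc | hc
  · exact hginj (hc.symm.trans hcb)
  · exact absurd (hcb ▸ hc) (hgfresh b)
end

section
/- Let A be a nonempty finite set, a_1,…,a_n ∈ A, f : A → ℕ, and (Q_{p,i,j})_{p≤n, i,j∈{1,2}} a family of subsets of A satisfying: (Transitivity) for all b,c ∈ A, p,q ≤ n and i,j,k,ℓ ∈ {1,2}, if b ∈ Q_{p,i,j}, c ∈ Q_{p,i,ℓ} and b ∈ Q_{q,k,j}, then c ∈ Q_{q,k,ℓ}; (Reflexivity) a_p ∈ Q_{p,i,i} for all p ≤ n, i ∈ {1,2}; (Uniqueness) for all b ∈ A, if either for every j ∈ {1,2} there are p,i with b ∈ Q_{p,i,j}, or b ∉ Q_{p,i,j} for all p,i,j, then every c ∈ A with f(c) = f(b) satisfies c = b. Then there exist functions f_1,f_2 : A → ℕ such that for all b ∈ A, p ≤ n and i,j ∈ {1,2}: b ∈ Q_{p,i,j} if and only if f_i(a_p) = f_j(b); moreover f_1,f_2 can be chosen so that for every b ∈ A with exactly one index j ∈ {1,2} satisfying f_j(b) ∉ {f_i(a_p) : p ≤ n,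 i ∈ {1,2}}, one has f_j(b) = f(b). -/
/-- a 1-data structure whose predicates `Q_{p,i,j}` satisfy
transitivity, reflexivity and uniqueness arises from a 2-data structure:
there are data functions `F 0, F 1` realising the predicates, which moreover
agree with the given data function `f` on every element having exactly one
field value outside the values of the designated tuple. -/
theorem well_formed_is_abstraction {A : Type} [Finite A] [Nonempty A] {n : ℕ}
    (a : Fin n → A) (f : A → ℕ) (Q : Fin n → Fin 2 → Fin 2 → Set A)
    (htrans : ∀ (b c : A) (p q : Fin n) (i j k ℓ : Fin 2),
      b ∈ Q p i j → c ∈ Q p i ℓ → b ∈ Q q k j → c ∈ Q q k ℓ)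
    (hrefl : ∀ (p : Fin n) (i : Fin 2), a p ∈ Q p i i)
    (huniq : ∀ b : A,
      ((∀ j : Fin 2, ∃ (p : Fin n) (i : Fin 2), b ∈ Q p i j) ∨
       (∀ (p : Fin n) (i j : Fin 2), b ∉ Q p i j)) →
      ∀ c : A, f c = f b → c = b) :
    ∃ F : Fin 2 → A → ℕ,
      (∀ (b : A) (p : Fin n) (i j : Fin 2), b ∈ Q p i j ↔ F i (a p) = F j b) ∧
      (∀ (b : A) (j : Fin 2),
        (F j b ∉ {v | ∃ (p : Fin n) (i : Fin 2), F i (a p) = v} ∧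
          ∀ j' : Fin 2,
            F j' b ∉ {v | ∃ (p : Fin n) (i : Fin 2), F i (a p) = v} → j' = j) →
        F j b = f b) := by
  classical
  let G : Fin 2 → A → Set (Fin n × Fin 2) := fun j b ↦ {x | b ∈ Q x.1 x.2 j}
  obtain ⟨code, hcode⟩ := Countable.exists_injective_nat (Set (Fin n × Fin 2))
  obtain ⟨M, hM⟩ := (Set.finite_range f).bddAbove
  let F : Fin 2 → A → ℕ := fun j b ↦ if (G j b).Nonempty then M + 1 + code (G j b) else f b
  have hself (p : Fin n) (i : Fin 2) : (p, i) ∈ G i (a p) := hrefl p i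
  have hmem (b : A) (p : Fin n) (i j : Fin 2) : b ∈ Q p i j ↔ G i (a p) = G j b := by
    constructor
    · intro hb
      ext ⟨q, k⟩
      exact ⟨fun h ↦ htrans (a p) b p q i i k j (hrefl p i) hb h,
        fun h ↦ htrans b (a p) p q i j k i hb (hrefl p i) h⟩
    · intro h
      have hpi := hself p i
      rwa [h] at hpi
  have hF (b : A) (p : Fin n) (i j : Fin 2) : b ∈ Q p i j ↔ F i (a p) = F j b := by
    have hFa : F i (a p) = M + 1 + code (G i (a p)) := if_pos ⟨_, hself p i⟩
    rw [hmem, hFa]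
    by_cases hb : (G j b).Nonempty
    · have hFb : F j b = M + 1 + code (G j b) := if_pos hb
      rw [hFb, Nat.add_left_cancel_iff, hcode.eq_iff]
    · have hFb : F j b = f b := if_neg hb
      have hle : f b ≤ M := hM ⟨b, rfl⟩
      refine ⟨fun h ↦ absurd ⟨_, h ▸ hself p i⟩ hb, fun h ↦ ?_⟩
      omega
  refine ⟨F, hF, fun b j hb ↦ if_neg ?_⟩
  rintro ⟨⟨p, i⟩, h⟩
  exact hb.1 ⟨p, i, (hF b p i j).1 h⟩
end

section
/- Let 𝔄 = (A,(P_σ),f_1,f_2) be a 2-data structure over Σ and let 𝔄^ge be the 2-data structure over Σ ∪ {ge} with universe A' = A ⊎ (Values(𝔄) × Values(𝔄)), where the data functions extend f_1, f_2 on A, a new element (d_1,d_2) carries first value d_1 and second value d_2, the predicates P_σ (σ ∈ Σ) are unchanged, and P_ge = Values(𝔄) × Values(𝔄). Then for all a,b ∈ A' and all i,j ∈ {1,2}, the distance between (a,i) and (b,j) in the data graph of 𝔄^ge is at most 3; consequently, for every a ∈ A' the 3-view of a in 𝔄^ge equals 𝔄^ge. -/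
/-- Universe of `𝔄^ge` : the original elements together with one new element
for every pair of data values of `𝔄`. -/
def GeUniv {A : Type} (f : Fin 2 → A → ℕ) : Type :=
  A ⊕ ({v : ℕ // v ∈ dataValues f} × {v : ℕ // v ∈ dataValues f})

/-- Data functions of `𝔄^ge`: they extend `f_1, f_2` on `A`, and the new element
`(d₁,d₂)` carries first value `d₁` and second value `d₂`. -/
def geData {A : Type} (f : Fin 2 → A → ℕ) : Fin 2 → GeUniv f → ℕ :=
  fun i x =>
    match x with
    | Sum.inl a => f i a
    | Sum.inr d => ![d.1.1, d.2.1] i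

/-- Every value carried by `𝔄^ge` already occurs in `𝔄`. -/
theorem geData_mem_dataValues {A : Type} (f : Fin 2 → A → ℕ) (i : Fin 2) (x : GeUniv f) :
    geData f i x ∈ dataValues f := by
  rcases x with a | d
  · exact ⟨a, i, rfl⟩
  · fin_cases i
    · exact d.1.2
    · exact d.2.2

/-- The new element carrying the two given values links any two element-fields. -/
theorem distLE_geData_three {A : Type} (f : Fin 2 → A → ℕ) (v w : GeUniv f × Fin 2) :
    distLE (geData f) 3 v w := by
  let e : GeUniv f := Sum.inr
    (⟨_, geData_mem_dataValues f v.2 v.1⟩, ⟨_, geData_mem_dataValues f w.2 w.1⟩)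
  exact ⟨(e, 1), ⟨(e, 0), ⟨v, rfl, Or.inr rfl⟩, Or.inl rfl⟩, Or.inr rfl⟩

/-- in the data graph of `𝔄^ge` all pairs of element-fields are at
distance at most `3`; consequently the 3-view of any element of `𝔄^ge`
equals `𝔄^ge` (its data functions are unchanged). -/
theorem ge_structure_has_radius_three {A : Type} [Finite A] [Nonempty A]
    {Sg : Type} (P : Sg → Set A) (f : Fin 2 → A → ℕ) :
    (∀ (x y : GeUniv f) (i j : Fin 2), distLE (geData f) 3 (x, i) (y, j)) ∧
    (∀ (a : GeUniv f) (fnew : GeUniv f × Fin 2 → ℕ),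
      Function.Injective fnew → (∀ v, fnew v ∉ dataValues (geData f)) →
      ∀ g : Fin 2 → GeUniv f → ℕ, IsView (geData f) 3 a fnew g → g = geData f) := by
  refine ⟨fun x y i j => distLE_geData_three f (x, i) (y, j), fun a fnew _ _ g hg => ?_⟩
  funext i x
  exact (hg x i).1 ⟨0, distLE_geData_three f (a, 0) (x, i)⟩
end

section
/- For every sentence φ of dFO¹[Σ]: there exists a 1-data structure 𝔄 over Σ with 𝔄 ⊨ φ if and only if there exist a 2-data structure 𝔅 over Σ and an element a of 𝔅 such that the 2-view 𝔅|_a^2 satisfies φ, where φ is read as a dFO²[Σ] formula not mentioning the second data values (i.e., 𝔅 satisfies ∃x.⟨φ⟩_x^2). -/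
/-- Formulas of `dFO^D[Σ]`: unary predicates, data relations `x ∼_{i,j} y`,
equality, disjunction, negation and existential quantification.
Variables are represented by natural numbers. -/
inductive DFO (Sg : Type) (D : ℕ) : Type
  | pred : Sg → ℕ → DFO Sg D
  | rel : Fin D → Fin D → ℕ → ℕ → DFO Sg D
  | eq : ℕ → ℕ → DFO Sg D
  | or : DFO Sg D → DFO Sg D → DFO Sg D
  | not : DFO Sg D → DFO Sg D
  | ex : ℕ → DFO Sg D → DFO Sg D

/-- Satisfaction `𝔄 ⊨_I φ` over the `D`-data structure with universe `A`,
predicates `P` and data functions `f`. -/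
def DFO.Sat {Sg : Type} {D : ℕ} {A : Type} (P : Sg → Set A) (f : Fin D → A → ℕ) :
    DFO Sg D → (ℕ → A) → Prop
  | .pred σ x, I => I x ∈ P σ
  | .rel i j x y, I => f i (I x) = f j (I y)
  | .eq x y, I => I x = I y
  | .or φ ψ, I => DFO.Sat P f φ I ∨ DFO.Sat P f ψ I
  | .not φ, I => ¬ DFO.Sat P f φ I
  | .ex x φ, I => ∃ a : A, DFO.Sat P f φ (Function.update I x a)

/-- `𝔄 ⊨ φ` : satisfaction under some interpretation function. -/
def DFO.Models {Sg : Type} {D : ℕ} {A : Type} (P : Sg → Set A)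
    (f : Fin D → A → ℕ) (φ : DFO Sg D) : Prop :=
  ∃ I : ℕ → A, DFO.Sat P f φ I

/-- Free variables of a formula. -/
def DFO.free {Sg : Type} {D : ℕ} : DFO Sg D → Finset ℕ
  | .pred _ x => {x}
  | .rel _ _ x y => {x, y}
  | .eq x y => {x, y}
  | .or φ ψ => φ.free ∪ ψ.free
  | .not φ => φ.free
  | .ex x φ => φ.free.erase x

/-- Conjunction, as the usual abbreviation. -/
def DFO.and {Sg : Type} {D : ℕ} (φ ψ : DFO Sg D) : DFO Sg D :=
  .not (.or (.not φ) (.not ψ))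

/-- Reading a `dFO^D[Σ]` formula as a `dFO^{D'}[Σ]` formula (`D ≤ D'`): the
formula simply never mentions the extra data values. -/
def DFO.castLE {Sg : Type} {D D' : ℕ} (h : D ≤ D') : DFO Sg D → DFO Sg D'
  | .pred σ x => .pred σ x
  | .rel i j x y => .rel (Fin.castLE h i) (Fin.castLE h j) x y
  | .eq x y => .eq x y
  | .or φ ψ => .or (φ.castLE h) (ψ.castLE h)
  | .not φ => .not (φ.castLE h)
  | .ex x φ => .ex x (φ.castLE h)

/-- A formula that only mentions the first `D` data values is evaluated on the reduct
to these values. -/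
theorem DFO.sat_castLE {Sg A : Type} {D D' : ℕ} (h : D ≤ D') (P : Sg → Set A)
    (f : Fin D' → A → ℕ) (φ : DFO Sg D) (I : ℕ → A) :
    DFO.Sat P f (φ.castLE h) I ↔ DFO.Sat P (fun i => f (Fin.castLE h i)) φ I := by
  induction φ generalizing I with
  | pred | rel | eq => rfl
  | or φ ψ ihφ ihψ => exact or_congr (ihφ I) (ihψ I)
  | not φ ih => exact not_congr (ih I)
  | ex x φ ih => exact exists_congr fun _ => ih _

theorem dataValues_finite {A : Type} [Finite A] {D : ℕ} (f : Fin D → A → ℕ) :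
    (dataValues f).Finite :=
  (Set.finite_range fun p : A × Fin D => f p.2 p.1).subset
    fun _ ⟨b, i, h⟩ => ⟨(b, i), h⟩

/-- Fresh values exist: a countable type injects into the complement of a finite set of naturals. -/
theorem exists_injective_notMem {V : Type} [Countable V] {S : Set ℕ} (hS : S.Finite) :
    ∃ g : V → ℕ, Function.Injective g ∧ ∀ v, g v ∉ S := by
  have := hS.infinite_compl.to_subtype
  obtain ⟨e₀⟩ := nonempty_embedding_nat V
  let e := e₀.trans (Infinite.natEmbedding (Sᶜ : Set ℕ))
  exact ⟨fun v => e v, Subtype.val_injective.comp e.injective, fun v => (e v).2⟩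

theorem exists_isView {A : Type} {D : ℕ} (f : Fin D → A → ℕ) (r : ℕ) (a : A)
    (fnew : A × Fin D → ℕ) : ∃ f', IsView f r a fnew f' := by
  classical
  exact ⟨fun i b => if inBall f r a (b, i) then f i b else fnew (b, i),
    fun _ _ => ⟨fun h => if_pos h, fun h => if_neg h⟩⟩

/-- If all elements share the `i`-th data value, every ball of radius two is everything. -/
theorem inBall_two_of_const {A : Type} {D : ℕ} {f : Fin D → A → ℕ} {i : Fin D}
    (hi : ∀ b c, f i b = f i c) (a : A) (v : A × Fin D) : inBall f 2 a v :=
  ⟨i, (v.1, i), ⟨(a, i), rfl, Or.inr (hi a v.1)⟩, Or.inl rfl⟩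

/-- a sentence `φ` of `dFO¹[Σ]` is satisfiable over 1-data
structures iff some 2-data structure `𝔅` over `Σ` has an element `a` whose
2-view satisfies `φ` (read as a `dFO²[Σ]` formula not mentioning the second
data values), i.e. iff `∃x.⟨φ⟩_x^2` is satisfiable over 2-data structures. -/
theorem one_data_to_two_data_radius_two {Sg : Type} (φ : DFO Sg 1)
    (hφ : φ.free = ∅) :
    (∃ (A : Type) (_ : Finite A) (_ : Nonempty A)
        (P : Sg → Set A) (f : Fin 1 → A → ℕ), DFO.Models P f φ) ↔
    (∃ (B : Type) (_ : Finite B) (_ : Nonempty B)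
        (Q : Sg → Set B) (g : Fin 2 → B → ℕ) (a : B),
      ∀ fnew : B × Fin 2 → ℕ, Function.Injective fnew →
        (∀ v, fnew v ∉ dataValues g) →
        ∀ g' : Fin 2 → B → ℕ, IsView g 2 a fnew g' →
          DFO.Models Q g' (φ.castLE (by omega))) := by
  constructor
  · rintro ⟨A, hA, hne, P, f, I, hI⟩
    obtain ⟨a⟩ := hne
    refine ⟨A, hA, ⟨a⟩, P, ![f 0, fun _ => 0], a, fun fnew _ _ g' hg' => ⟨I, ?_⟩⟩
    have hf : (fun i => g' (Fin.castLE (by omega) i)) = f := by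
      funext i b
      obtain rfl := Subsingleton.elim i 0
      exact (hg' b 0).1 (inBall_two_of_const (i := 1) (fun _ _ => rfl) a _)
    rw [DFO.sat_castLE, hf]
    exact hI
  · rintro ⟨B, hB, hne, Q, g, a, h⟩
    obtain ⟨fnew, hinj, hfresh⟩ := exists_injective_notMem (V := B × Fin 2) (dataValues_finite g)
    obtain ⟨g', hg'⟩ := exists_isView g 2 a fnew
    obtain ⟨I, hI⟩ := h fnew hinj hfresh g' hg'
    exact ⟨B, hB, hne, Q, _, I, (DFO.sat_castLE _ Q g' φ I).1 hI⟩
end
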